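/- arXiv:2102.06188 — 2 statements merged into one kernel-verified Lean document; each statement's English description precedes it below -/
import Mathlib

section
/- Let n ≥ 2, f ≥ 1, D ⊆ {1,…,n−1}, and let λ ∈ ℤ^n satisfy (H_f). Let w ∈ S_n be D-admissible with w·λ'_D dominant. Then both fθ − w·λ and fθ − w·λ'_D are ℚ≥0-linear combinations of the simple roots, and supp(fθ − w·λ'_D) = w(D) ∪ supp(fθ − w·λ); in particular w(D) ⊆ supp(fθ − w·λ'_D). Moreover, the subset w(D) ∪ supp(fθ − w·λ) of {1,…,n−1} is the same for every D-admissible w with w·λ'_D dominant. (Paper: Lemma 'parabolic'(ii) and Proposition 'parabolicprop'(ii) in §2.2, for G = GL_n; this set is S(P(C_P)) for the isotypic component C_P attached to λ.) -/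
/-!
Setup (§2.2 of the paper, for `G = GL_n`): the symmetric group `S_n` acts on `ℚ^n` by
permuting coordinates, `(w • v) k = v (w⁻¹ k)`.  Coordinates are indexed by `Fin n`
(`0`-based), so the simple roots are `α i = e i − e (i+1)` for `i ∈ {0, …, n−2}`
(the paper's `α_{i+1}`), subsets of simple roots are subsets of
`{0, …, n−2} = Finset.range (n−1)`, and `θ = (n−1, n−2, …, 1, 0)`.
-/

namespace BHHMS

/-- The standard basis vector `e i` of `ℚ^n`. -/
def stde (n i : ℕ) : Fin n → ℚ := fun k => if (k : ℕ) = i then 1 else 0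

/-- The simple root `α i = e i − e (i+1)`, for `i ∈ {0, …, n−2}`. -/
def simpleRoot (n i : ℕ) : Fin n → ℚ := stde n i - stde n (i + 1)

/-- The action of `S_n` on `ℚ^n` permuting the coordinates: `(w • v) k = v (w⁻¹ k)`. -/
def permAct (n : ℕ) (w : Equiv.Perm (Fin n)) (v : Fin n → ℚ) : Fin n → ℚ :=
  fun k => v (w⁻¹ k)

/-- `v ≤ v'` iff `v' − v` is a `ℚ≥0`-linear combination of the simple roots. -/
def rootLE (n : ℕ) (v v' : Fin n → ℚ) : Prop :=
  ∃ c : ℕ → ℚ, (∀ i, 0 ≤ c i) ∧ v' - v = ∑ i ∈ Finset.range (n - 1), c i • simpleRoot n i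

/-- `v` is dominant iff `v 0 ≥ v 1 ≥ … ≥ v (n−1)`. -/
def Dominant (n : ℕ) (v : Fin n → ℚ) : Prop := ∀ i j : Fin n, i ≤ j → v j ≤ v i

/-- The adjacent transposition `s i = (i, i+1)` (junk value `1` if `i + 1 ≥ n`). -/
def adjSwap (n i : ℕ) : Equiv.Perm (Fin n) :=
  if h : i + 1 < n then Equiv.swap ⟨i, Nat.lt_of_succ_lt h⟩ ⟨i + 1, h⟩ else 1

/-- The subgroup `W_D ⊆ S_n` generated by the `s i` for `i ∈ D`. -/
def WD (n : ℕ) (D : Finset ℕ) : Subgroup (Equiv.Perm (Fin n)) :=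
  Subgroup.closure (adjSwap n '' ↑D)

/-- `Σ_{w ∈ W_D} w·v`. -/
noncomputable def WDsum (n : ℕ) (D : Finset ℕ) (v : Fin n → ℚ) : Fin n → ℚ :=
  ∑ᶠ w ∈ WD n D, permAct n w v

/-- The `W_D`-average `λ'_D = |W_D|⁻¹ Σ_{w ∈ W_D} w·λ`. -/
noncomputable def avg (n : ℕ) (D : Finset ℕ) (v : Fin n → ℚ) : Fin n → ℚ :=
  ((Nat.card ↥(WD n D) : ℚ))⁻¹ • WDsum n D v

/-- For `v` of coordinate sum `0`, writing `v = Σ_i c_i • α_i` one has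
`c_i = v 0 + ⋯ + v i`; then `supp v = {i : c_i ≠ 0}`. -/
def suppOf (n : ℕ) (v : Fin n → ℚ) : Finset ℕ :=
  (Finset.range (n - 1)).filter fun i => (∑ k : Fin n, if (k : ℕ) ≤ i then v k else 0) ≠ 0

/-- `w` is `D`-admissible iff `w (i+1) = w i + 1` for every `i ∈ D`. -/
def IsAdmissible (n : ℕ) (D : Finset ℕ) (w : Equiv.Perm (Fin n)) : Prop :=
  ∀ i ∈ D, ∀ h : i + 1 < n,
    ((w ⟨i + 1, h⟩ : Fin n) : ℕ) = ((w ⟨i, Nat.lt_of_succ_lt h⟩ : Fin n) : ℕ) + 1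

/-- The image `w(D) = {w i : i ∈ D}` as a subset of `ℕ`. -/
def permImage (n : ℕ) (w : Equiv.Perm (Fin n)) (D : Finset ℕ) : Finset ℕ :=
  D.image fun i => if h : i < n then ((w ⟨i, h⟩ : Fin n) : ℕ) else i

/-- `θ = (n−1, n−2, …, 1, 0)`. -/
def theta (n : ℕ) : Fin n → ℚ := fun k => (n : ℚ) - 1 - ((k : ℕ) : ℚ)

/-- A vector of `ℤ^n` seen in `ℚ^n`. -/
def ratVec (n : ℕ) (lam : Fin n → ℤ) : Fin n → ℚ := fun k => ((lam k : ℤ) : ℚ)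

/-- `λ ∈ ℤ^n` satisfies `(H_f)` iff `σ·λ ≤ fθ` for every `σ ∈ S_n`. -/
def SatisfiesHf (n f : ℕ) (lam : Fin n → ℤ) : Prop :=
  ∀ σ : Equiv.Perm (Fin n), rootLE n (permAct n σ (ratVec n lam)) ((f : ℚ) • theta n)

/-- The linear form `v ↦ ∑ v k` over the coordinates `k < m`. -/
def partialSum (n m : ℕ) : (Fin n → ℚ) →ₗ[ℚ] ℚ :=
  ∑ k : Fin n, if (k : ℕ) < m then LinearMap.proj k else 0

theorem partialSum_apply (n m : ℕ) (v : Fin n → ℚ) :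
    partialSum n m v = ∑ k : Fin n, if (k : ℕ) < m then v k else 0 := by
  simp only [partialSum, LinearMap.sum_apply]
  refine Finset.sum_congr rfl fun k _ => ?_
  split_ifs <;> rfl

theorem mem_suppOf {n i : ℕ} {v : Fin n → ℚ} :
    i ∈ suppOf n v ↔ i < n - 1 ∧ partialSum n (i + 1) v ≠ 0 := by
  simp [suppOf, partialSum_apply]

theorem partialSum_succ {n : ℕ} (v : Fin n → ℚ) (i : Fin n) :
    partialSum n (i + 1) v = partialSum n i v + v i := by
  have h : ∀ k : Fin n, (if (k : ℕ) < i + 1 then v k else 0)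
      = (if (k : ℕ) < i then v k else 0) + if k = i then v k else 0 := by
    intro k
    rcases lt_trichotomy k i with hk | rfl | hk
    · have := Fin.lt_def.mp hk
      simp [hk.ne, this, Nat.lt_succ_of_lt this]
    · simp
    · have := Fin.lt_def.mp hk
      simp [hk.ne', not_lt.mpr this.le, show ¬ (k : ℕ) < i + 1 by omega]
  simp only [partialSum_apply, h, Finset.sum_add_distrib]
  simp

theorem partialSum_stde (n m i : ℕ) :
    partialSum n m (stde n i) = if i < m ∧ i < n then 1 else 0 := by
  rw [partialSum_apply]
  by_cases hi : i < n
  · rw [Finset.sum_eq_single (⟨i, hi⟩ : Fin n)]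
    · simp [stde, hi]
    · intro k _ hk
      have hki : (k : ℕ) ≠ i := fun h => hk (Fin.ext h)
      simp [stde, hki]
    · simp
  · rw [Finset.sum_eq_zero]
    · simp [hi]
    · intro k _
      simp [stde, show (k : ℕ) ≠ i by omega]

theorem partialSum_simpleRoot_nonneg (n m i : ℕ) : 0 ≤ partialSum n m (simpleRoot n i) := by
  rw [simpleRoot, map_sub, partialSum_stde, partialSum_stde]
  split_ifs <;> first | omega | norm_num

theorem rootLE.partialSum_nonneg {n : ℕ} {v v' : Fin n → ℚ} (h : rootLE n v v') (m : ℕ) :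
    0 ≤ partialSum n m (v' - v) := by
  obtain ⟨c, hc, h⟩ := h
  rw [h, map_sum]
  refine Finset.sum_nonneg fun i _ => ?_
  rw [map_smul]
  exact mul_nonneg (hc i) (partialSum_simpleRoot_nonneg n m i)

theorem partialSum_permAct (n m : ℕ) (σ : Equiv.Perm (Fin n)) (v : Fin n → ℚ) :
    partialSum n m (permAct n σ v) = ∑ k : Fin n, if (σ k : ℕ) < m then v k else 0 := by
  rw [partialSum_apply, ← Equiv.sum_comp σ]
  simp [permAct]

open Classical in
theorem sub_permAct_avg (n : ℕ) (D : Finset ℕ) (w : Equiv.Perm (Fin n)) (b v : Fin n → ℚ) :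
    b - permAct n w (avg n D v)
      = (Nat.card (WD n D) : ℚ)⁻¹ • ∑ u : WD n D, (b - permAct n (w * u) v) := by
  have hcard : (Nat.card (WD n D) : ℚ) ≠ 0 := Nat.cast_ne_zero.mpr Nat.card_pos.ne'
  have hsum : WDsum n D v = ∑ u : WD n D, permAct n u v := by
    rw [← finsum_eq_sum_of_fintype]
    exact (finsum_set_coe_eq_finsum_mem (WD n D : Set (Equiv.Perm (Fin n)))).symm
  ext k
  simp only [avg, hsum, permAct, Pi.sub_apply, Pi.smul_apply, Finset.sum_apply, smul_eq_mul,
    Finset.sum_sub_distrib, Finset.sum_const, Finset.card_univ, nsmul_eq_mul, mul_inv_rev,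
    Equiv.Perm.mul_apply, ← Nat.card_eq_fintype_card, Pi.mul_apply, Pi.natCast_apply]
  field_simp

theorem rootLE_permAct_avg {n : ℕ} {D : Finset ℕ} {w : Equiv.Perm (Fin n)} {b v : Fin n → ℚ}
    (h : ∀ σ : Equiv.Perm (Fin n), rootLE n (permAct n σ v) b) :
    rootLE n (permAct n w (avg n D v)) b := by
  classical
  choose c hc h using h
  refine ⟨fun i => (Nat.card (WD n D) : ℚ)⁻¹ * ∑ u : WD n D, c (w * u) i, fun i => ?_, ?_⟩
  · exact mul_nonneg (by positivity) (Finset.sum_nonneg fun u _ => hc _ i)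
  · rw [sub_permAct_avg]
    simp only [h]
    rw [Finset.sum_comm, Finset.smul_sum]
    simp only [mul_smul, Finset.sum_smul]

theorem partialSum_sub_permAct_avg_eq_zero_iff {n : ℕ} {D : Finset ℕ} {w : Equiv.Perm (Fin n)}
    {b v : Fin n → ℚ} (h : ∀ σ : Equiv.Perm (Fin n), rootLE n (permAct n σ v) b) (m : ℕ) :
    partialSum n m (b - permAct n w (avg n D v)) = 0
      ↔ ∀ u ∈ WD n D, partialSum n m (b - permAct n (w * u) v) = 0 := by
  classical
  have hcard : (Nat.card (WD n D) : ℚ)⁻¹ ≠ 0 :=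
    inv_ne_zero (Nat.cast_ne_zero.mpr Nat.card_pos.ne')
  rw [sub_permAct_avg, map_smul, map_sum, smul_eq_zero_iff_right hcard,
    Finset.sum_eq_zero_iff_of_nonneg fun u _ => (h _).partialSum_nonneg m]
  simp

theorem adjSwap_of_lt {n i : ℕ} (h : i + 1 < n) :
    adjSwap n i = Equiv.swap ⟨i, Nat.lt_of_succ_lt h⟩ ⟨i + 1, h⟩ :=
  dif_pos h

theorem mem_permImage {n i : ℕ} {w : Equiv.Perm (Fin n)} {D : Finset ℕ}
    (hD : D ⊆ Finset.range (n - 1)) :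
    i ∈ permImage n w D ↔ ∃ j ∈ D, ∃ h : j < n, (w ⟨j, h⟩ : ℕ) = i := by
  simp only [permImage, Finset.mem_image]
  refine exists_congr fun j => and_congr_right fun hj => ?_
  have hjn : j < n := by have := Finset.mem_range.mp (hD hj); omega
  simp [hjn]

theorem IsAdmissible.lt_iff_of_mem_WD {n i : ℕ} {D : Finset ℕ} {w : Equiv.Perm (Fin n)}
    (hw : IsAdmissible n D w) (hD : D ⊆ Finset.range (n - 1)) (hi : i ∉ permImage n w D)
    {u : Equiv.Perm (Fin n)} (hu : u ∈ WD n D) (k : Fin n) :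
    (w (u k) : ℕ) < i + 1 ↔ (w k : ℕ) < i + 1 := by
  rw [mem_permImage hD] at hi
  induction hu using Subgroup.closure_induction generalizing k with
  | mem x hx =>
    obtain ⟨j, hj, rfl⟩ := hx
    have hjn : j + 1 < n := by have := Finset.mem_range.mp (hD hj); omega
    have hne : (w ⟨j, Nat.lt_of_succ_lt hjn⟩ : ℕ) ≠ i := fun h => hi ⟨j, hj, _, h⟩
    have hadm := hw j hj hjn
    rw [adjSwap_of_lt hjn, Equiv.swap_apply_def]
    split_ifs with h₁ h₂
    · rw [h₁]; omega
    · rw [h₂]; omega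
    · rfl
  | one => rfl
  | mul x y _ _ hx hy => rw [Equiv.Perm.mul_apply, hx, hy]
  | inv x _ hx => simpa using (hx (x⁻¹ k)).symm

theorem IsAdmissible.permImage_subset_suppOf {n f : ℕ} {D : Finset ℕ} {w : Equiv.Perm (Fin n)}
    {v : Fin n → ℚ} (hw : IsAdmissible n D w) (hD : D ⊆ Finset.range (n - 1)) (hf : 1 ≤ f)
    (hv : ∀ σ : Equiv.Perm (Fin n), rootLE n (permAct n σ v) ((f : ℚ) • theta n)) :
    permImage n w D ⊆ suppOf n ((f : ℚ) • theta n - permAct n w (avg n D v)) := by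
  intro i hi
  obtain ⟨j, hj, hjn, rfl⟩ := (mem_permImage hD).mp hi
  have hjn' : j + 1 < n := by have := Finset.mem_range.mp (hD hj); omega
  have hadm := hw j hj hjn'
  set a := w ⟨j, hjn⟩ with ha
  set a' := w ⟨j + 1, hjn'⟩ with ha'
  refine mem_suppOf.mpr ⟨by omega, fun h0 => ?_⟩
  rw [partialSum_sub_permAct_avg_eq_zero_iff hv] at h0
  have h₁ := h0 1 (one_mem _)
  have h₂ := h0 (adjSwap n j) (Subgroup.subset_closure ⟨j, hj, rfl⟩)
  have hlow := (hv (w * adjSwap n j)).partialSum_nonneg a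
  have hhigh := (hv (w * 1)).partialSum_nonneg (a' + 1)
  rw [partialSum_succ] at h₂ hhigh
  rw [hadm, h₁] at hhigh
  have e₁ : permAct n (w * 1) v a' = v ⟨j + 1, hjn'⟩ := by simp [permAct, ha']
  have e₂ : permAct n (w * adjSwap n j) v a = v ⟨j + 1, hjn'⟩ := by
    simp [permAct, ha, adjSwap_of_lt hjn']
  simp only [Pi.sub_apply, Pi.smul_apply, smul_eq_mul, theta, e₁, e₂, hadm] at h₂ hhigh
  push_cast at hhigh
  have : (1 : ℚ) ≤ f := by exact_mod_cast hf
  linarith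

theorem IsAdmissible.suppOf_sub_permAct_avg {n f : ℕ} {D : Finset ℕ} {w : Equiv.Perm (Fin n)}
    {v : Fin n → ℚ} (hw : IsAdmissible n D w) (hD : D ⊆ Finset.range (n - 1)) (hf : 1 ≤ f)
    (hv : ∀ σ : Equiv.Perm (Fin n), rootLE n (permAct n σ v) ((f : ℚ) • theta n)) :
    suppOf n ((f : ℚ) • theta n - permAct n w (avg n D v))
      = permImage n w D ∪ suppOf n ((f : ℚ) • theta n - permAct n w v) := by
  refine subset_antisymm (fun i hi => ?_)
    (Finset.union_subset (hw.permImage_subset_suppOf hD hf hv) fun i hi => ?_)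
  · rw [Finset.mem_union, or_iff_not_imp_left]
    intro hiD
    rw [mem_suppOf] at hi ⊢
    refine ⟨hi.1, fun h0 => hi.2 ?_⟩
    rw [partialSum_sub_permAct_avg_eq_zero_iff hv]
    intro u hu
    rw [map_sub] at h0 ⊢
    rw [← h0]
    simp only [partialSum_permAct, Equiv.Perm.mul_apply, hw.lt_iff_of_mem_WD hD hiD hu]
  · rw [mem_suppOf] at hi ⊢
    refine ⟨hi.1, fun h0 => hi.2 ?_⟩
    rw [partialSum_sub_permAct_avg_eq_zero_iff hv] at h0
    simpa using h0 1 (one_mem _)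

theorem Dominant.permAct_eq {n : ℕ} {w w' : Equiv.Perm (Fin n)} {v : Fin n → ℚ}
    (h : Dominant n (permAct n w v)) (h' : Dominant n (permAct n w' v)) :
    permAct n w v = permAct n w' v :=
  Tuple.unique_antitone (f := v) (σ := w⁻¹) (τ := w'⁻¹) (fun i j => h i j) fun i j => h' i j

/-- Lemma `parabolic`(ii) and Proposition `parabolicprop`(ii), §2.2, for
`G = GL_n`.  Both `fθ − w·λ` and `fθ − w·λ'_D` are `ℚ≥0`-combinations of simple roots,
`supp (fθ − w·λ'_D) = w(D) ∪ supp (fθ − w·λ)` (in particular `w(D)` is contained in the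
left-hand side), and the set `w(D) ∪ supp (fθ − w·λ)` is independent of the choice of the
`D`-admissible `w` with `w·λ'_D` dominant. -/
theorem statement3 (n f : ℕ) (hn : 2 ≤ n) (hf : 1 ≤ f) (D : Finset ℕ)
    (hD : D ⊆ Finset.range (n - 1)) (lam : Fin n → ℤ) (hlam : SatisfiesHf n f lam)
    (w : Equiv.Perm (Fin n)) (hw : IsAdmissible n D w)
    (hdom : Dominant n (permAct n w (avg n D (ratVec n lam)))) :
    rootLE n (permAct n w (ratVec n lam)) ((f : ℚ) • theta n) ∧
    rootLE n (permAct n w (avg n D (ratVec n lam))) ((f : ℚ) • theta n) ∧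
    suppOf n ((f : ℚ) • theta n - permAct n w (avg n D (ratVec n lam)))
      = permImage n w D ∪ suppOf n ((f : ℚ) • theta n - permAct n w (ratVec n lam)) ∧
    permImage n w D ⊆ suppOf n ((f : ℚ) • theta n - permAct n w (avg n D (ratVec n lam))) ∧
    (∀ w' : Equiv.Perm (Fin n), IsAdmissible n D w' →
      Dominant n (permAct n w' (avg n D (ratVec n lam))) →
      permImage n w D ∪ suppOf n ((f : ℚ) • theta n - permAct n w (ratVec n lam))
        = permImage n w' D ∪ suppOf n ((f : ℚ) • theta n - permAct n w' (ratVec n lam))) := by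
  refine ⟨hlam w, rootLE_permAct_avg hlam, hw.suppOf_sub_permAct_avg hD hf hlam,
    hw.permImage_subset_suppOf hD hf hlam, fun w' hw' hdom' => ?_⟩
  rw [← hw.suppOf_sub_permAct_avg hD hf hlam, ← hw'.suppOf_sub_permAct_avg hD hf hlam,
    hdom.permAct_eq hdom']

end BHHMS
end

section
/- Let tr : 𝔽[K] → 𝔽[𝔽_p] be the 𝔽-algebra homomorphism of group algebras induced by the additive group homomorphism Tr_{K/𝔽_p} : K → 𝔽_p (the trace), and set Y := Σ_{a ∈ 𝔽_p^×} a⁻¹[a] ∈ 𝔽[𝔽_p], the coefficients a⁻¹ being read in 𝔽 via the prime field embedding 𝔽_p → 𝔽. Then tr(Y_j) = Y for every 0 ≤ j ≤ f−1, the map tr is surjective, and its kernel is the ideal of 𝔽[K] generated by the elements Y_i − Y_j for 0 ≤ i < j ≤ f−1. (Paper: Lemma 'lem:ker' in §3.2.2, at the level of the finite quotients N_0/N_0^p ≅ K and 𝔽_p.) -/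
/-!
Setup (§3.2.2 of the paper): `p > 2` is prime, `q = p^f`, `K` is a finite field with `q`
elements, `𝔽` a field with a ring embedding `σ₀ : K → 𝔽`, and `σ_j(a) = σ₀(a)^{p^j}`.
`𝔽[K]` is the group algebra over `𝔽` of the additive group of `K`
(`AddMonoidAlgebra 𝔽 K`), with canonical basis `[a] = AddMonoidAlgebra.single a 1`, and
`Y_j = Σ_{a ∈ K^×} σ_j(a)^{−1} [a]`.
-/

namespace BHHMS

/-- `Y_j = Σ_{a ∈ K^×} σ_j(a)^{−1} [a] ∈ 𝔽[K]`, where `σ_j(a) = σ₀(a)^{p^j}`. -/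
noncomputable def Yelt (p : ℕ) {K 𝔽 : Type*} [Field K] [Fintype K] [DecidableEq K] [Field 𝔽]
    (σ₀ : K →+* 𝔽) (j : ℕ) : AddMonoidAlgebra 𝔽 K :=
  ∑ a : Kˣ, AddMonoidAlgebra.single ((a : K) : K) ((σ₀ (a : K) ^ p ^ j)⁻¹)

/-- `Y = Σ_{a ∈ 𝔽_p^×} a^{−1} [a] ∈ 𝔽[𝔽_p]`, the coefficients read in `𝔽` via the prime
field embedding `𝔽_p → 𝔽`. -/
noncomputable def Ystd (p : ℕ) [NeZero p] (𝔽 : Type*) [Field 𝔽] [Algebra (ZMod p) 𝔽] :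
    AddMonoidAlgebra 𝔽 (ZMod p) :=
  ∑ a : (ZMod p)ˣ,
    AddMonoidAlgebra.single ((a : ZMod p) : ZMod p) (algebraMap (ZMod p) 𝔽 ((a : ZMod p)⁻¹))

open Polynomial in
/-- The reciprocals of the elements of trace `b ≠ 0` in a finite field add up to `b⁻¹`: they are the
roots of the split separable polynomial `∑ X ^ p ^ i - b`, so that the sum is minus its logarithmic
derivative at `0`. -/
lemma sum_inv_of_trace_eq_of_ne_zero (p : ℕ) [Fact p.Prime] (K : Type*) [Field K] [Fintype K]
    [Algebra (ZMod p) K] {b : ZMod p} (hb : b ≠ 0) :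
    ∑ a : K with Algebra.trace (ZMod p) K a = b, a⁻¹ = algebraMap (ZMod p) K b⁻¹ := by
  classical
  have : CharP K p := charP_of_injective_algebraMap (algebraMap (ZMod p) K).injective p
  set n := Module.finrank (ZMod p) K with hn
  have hn0 : 0 < n := Module.finrank_pos
  have hcard : Fintype.card K = p ^ n := by
    rw [Module.card_eq_pow_finrank (K := ZMod p), ZMod.card]
  have hp1 : 1 < p := (Fact.out : p.Prime).one_lt
  set P : K[X] := ∑ i ∈ Finset.range n, X ^ p ^ i - C (algebraMap (ZMod p) K b) with hP
  have heval (x : K) : P.eval x =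
      algebraMap (ZMod p) K (Algebra.trace (ZMod p) K x) - algebraMap (ZMod p) K b := by
    simp [hP, FiniteField.algebraMap_trace_eq_sum_pow, eval_finsetSum, hn]
  have hPP : P ^ p - P = X ^ Fintype.card K - X := by
    have h1 : (∑ i ∈ Finset.range n, (X : K[X]) ^ p ^ i) ^ p =
        ∑ i ∈ Finset.range n, X ^ p ^ (i + 1) := by
      rw [sum_pow_char]
      simp [← pow_mul, pow_succ]
    have h2 := Finset.sum_range_sub (fun i ↦ (X : K[X]) ^ p ^ i) n
    rw [Finset.sum_sub_distrib] at h2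
    rw [hP, sub_pow_char, h1, ← C_pow, ← map_pow, ZMod.pow_card, sub_sub_sub_cancel_right, h2,
      hcard, pow_zero, pow_one]
  have hdvd : P ∣ X ^ Fintype.card K - X := by
    rw [← hPP]
    exact dvd_sub (dvd_pow_self _ (by omega)) dvd_rfl
  have hne : (X ^ Fintype.card K - X : K[X]) ≠ 0 :=
    FiniteField.X_pow_card_sub_X_ne_zero K Fintype.one_lt_card
  have hsplit : P.Splits := by
    have h := Polynomial.splits_X_pow_nat_card_sub_X (K := K)
    rw [Nat.card_eq_fintype_card] at h
    exact h.of_dvd hne hdvd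
  have hnodup : P.roots.Nodup := by
    have h := roots.le_of_dvd hne hdvd
    rw [FiniteField.roots_X_pow_card_sub_X] at h
    exact Multiset.nodup_of_le h Finset.univ.nodup
  have hroots : P.roots.toFinset = Finset.univ.filter fun a : K ↦ Algebra.trace (ZMod p) K a = b := by
    ext x
    rw [Multiset.mem_toFinset, mem_roots (ne_zero_of_dvd_ne_zero hne hdvd), IsRoot, heval, sub_eq_zero]
    simp
  have h0 : P.eval 0 = - algebraMap (ZMod p) K b := by rw [heval]; simp
  have hd : P.derivative.eval 0 = 1 := by
    rw [← coeff_zero_eq_eval_zero, coeff_derivative, hP]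
    have (i : ℕ) : (1 = p ^ i) ↔ i = 0 := by
      rw [eq_comm, Nat.pow_eq_one]; omega
    simp [coeff_X_pow, this, hn0]
  have hne0 : P.eval 0 ≠ 0 := by rw [h0]; simpa using hb
  have key := hsplit.eval_derivative_div_eval_of_ne_zero hne0
  rw [h0, hd] at key
  have : (P.roots.map fun z ↦ 1 / (0 - z)).sum =
      ∑ a : K with Algebra.trace (ZMod p) K a = b, 1 / (0 - a) := by
    rw [← hroots, Finset.sum, Multiset.toFinset_val, Multiset.dedup_eq_self.2 hnodup]
  rw [this] at key
  rw [map_inv₀, ← neg_inj, ← Finset.sum_neg_distrib]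
  simpa [inv_neg] using key.symm

/-- The reciprocals of the elements of trace `b` in a finite field of odd characteristic add up to
`b⁻¹`, with the convention `0⁻¹ = 0`. -/
lemma sum_inv_of_trace_eq (p : ℕ) [Fact p.Prime] (hp : 2 < p) (K : Type*) [Field K] [Fintype K]
    [Algebra (ZMod p) K] (b : ZMod p) :
    ∑ a : K with Algebra.trace (ZMod p) K a = b, a⁻¹ = algebraMap (ZMod p) K b⁻¹ := by
  obtain rfl | hb := eq_or_ne b 0
  · have : CharP K p := charP_of_injective_algebraMap (algebraMap (ZMod p) K).injective p
    have h2 : (2 : K) ≠ 0 := Ring.two_ne_zero (by rw [ringChar.eq K p]; omega)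
    have hneg : ∑ a : K with Algebra.trace (ZMod p) K a = 0, a⁻¹ =
        - ∑ a : K with Algebra.trace (ZMod p) K a = 0, a⁻¹ := by
      rw [← Finset.sum_neg_distrib]
      exact Finset.sum_equiv (Equiv.neg K) (by simp) (by simp [inv_neg])
    rw [inv_zero, map_zero]
    have := eq_neg_iff_add_eq_zero.1 hneg
    rw [← two_mul] at this
    exact (mul_eq_zero.1 this).resolve_left h2
  · exact sum_inv_of_trace_eq_of_ne_zero p K hb

lemma ringHom_algebraMap_zmod {p : ℕ} {K 𝔽 : Type*} [Field K] [Algebra (ZMod p) K] [Field 𝔽]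
    [Algebra (ZMod p) 𝔽] (σ₀ : K →+* 𝔽) (c : ZMod p) :
    σ₀ (algebraMap (ZMod p) K c) = algebraMap (ZMod p) 𝔽 c :=
  congr($(Subsingleton.elim (σ₀.comp (algebraMap (ZMod p) K)) (algebraMap (ZMod p) 𝔽)) c)

lemma sum_units_eq_sum {K M : Type*} [Field K] [Fintype K] [DecidableEq K] [AddCommMonoid M]
    (g : K → M) (h0 : g 0 = 0) : ∑ a : Kˣ, g a = ∑ a : K, g a := by
  rw [← Finset.sum_erase Finset.univ h0]
  exact Finset.sum_nbij (fun a : Kˣ ↦ (a : K)) (by simp) (fun a _ b _ h ↦ Units.ext h)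
    (fun x hx ↦ ⟨Units.mk0 x (by simpa using hx), by simp⟩) (by simp)

lemma mapDomainRingHom_trace_Yelt (p : ℕ) [Fact p.Prime] [NeZero p] (hp : 2 < p)
    {K 𝔽 : Type*} [Field K] [Fintype K] [DecidableEq K] [Algebra (ZMod p) K]
    [Field 𝔽] [Algebra (ZMod p) 𝔽] (σ₀ : K →+* 𝔽) (j : ℕ) :
    AddMonoidAlgebra.mapDomainRingHom 𝔽 (Algebra.trace (ZMod p) K).toAddMonoidHom
      (Yelt p σ₀ j) = Ystd p 𝔽 := by
  have : CharP 𝔽 p := charP_of_injective_algebraMap (algebraMap (ZMod p) 𝔽).injective p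
  have hY : AddMonoidAlgebra.mapDomainRingHom 𝔽 (Algebra.trace (ZMod p) K).toAddMonoidHom
      (Yelt p σ₀ j) = ∑ a : K, AddMonoidAlgebra.single (Algebra.trace (ZMod p) K a)
        ((σ₀ a ^ p ^ j)⁻¹) := by
    rw [Yelt, map_sum, ← sum_units_eq_sum (fun a : K ↦
      AddMonoidAlgebra.single (Algebra.trace (ZMod p) K a) ((σ₀ a ^ p ^ j)⁻¹))]
    · simp
    · simp [(Fact.out : p.Prime).ne_zero]
  have hS : Ystd p 𝔽 = ∑ b : ZMod p, AddMonoidAlgebra.single b (algebraMap (ZMod p) 𝔽 b⁻¹) := by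
    rw [Ystd, ← sum_units_eq_sum (fun b : ZMod p ↦
      AddMonoidAlgebra.single b (algebraMap (ZMod p) 𝔽 b⁻¹)) (by simp)]
  rw [hY, hS, ← Finset.sum_fiberwise Finset.univ (Algebra.trace (ZMod p) K)]
  refine Finset.sum_congr rfl fun b _ ↦ ?_
  have h1 : ∑ a : K with Algebra.trace (ZMod p) K a = b,
      AddMonoidAlgebra.single (Algebra.trace (ZMod p) K a) ((σ₀ a ^ p ^ j)⁻¹) =
      ∑ a : K with Algebra.trace (ZMod p) K a = b,
        AddMonoidAlgebra.singleAddHom b ((σ₀ a ^ p ^ j)⁻¹) :=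
    Finset.sum_congr rfl fun a ha ↦ by rw [(Finset.mem_filter.1 ha).2]; rfl
  rw [h1, ← map_sum]
  change AddMonoidAlgebra.single b _ = _
  congr 1
  calc ∑ a : K with Algebra.trace (ZMod p) K a = b, (σ₀ a ^ p ^ j)⁻¹
      = (σ₀ (∑ a : K with Algebra.trace (ZMod p) K a = b, a⁻¹)) ^ p ^ j := by
        rw [map_sum, sum_pow_char_pow]
        simp
    _ = algebraMap (ZMod p) 𝔽 b⁻¹ := by
        rw [sum_inv_of_trace_eq p hp, ringHom_algebraMap_zmod, ← map_pow, ZMod.pow_card_pow]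

/-- The augmentation ideal, generated by the elements `[a] - 1`. -/
noncomputable def augIdeal (K 𝔽 : Type*) [Field K] [Field 𝔽] : Ideal (AddMonoidAlgebra 𝔽 K) :=
  Ideal.span (Set.range fun a : K ↦ AddMonoidAlgebra.single a (1 : 𝔽) - 1)

section

variable {K 𝔽 : Type*} [Field K] [Field 𝔽]

lemma single_sub_one_mem_augIdeal (a : K) :
    AddMonoidAlgebra.single a (1 : 𝔽) - 1 ∈ augIdeal K 𝔽 :=
  Ideal.subset_span ⟨a, rfl⟩

lemma exists_sub_algebraMap_mem_augIdeal (x : AddMonoidAlgebra 𝔽 K) :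
    ∃ c : 𝔽, x - algebraMap 𝔽 _ c ∈ augIdeal K 𝔽 := by
  induction x using AddMonoidAlgebra.induction_linear with
  | zero => exact ⟨0, by simp⟩
  | add x y hx hy =>
    obtain ⟨c, hc⟩ := hx
    obtain ⟨d, hd⟩ := hy
    refine ⟨c + d, ?_⟩
    rw [map_add, add_sub_add_comm]
    exact add_mem hc hd
  | single a r =>
    refine ⟨r, ?_⟩
    have : AddMonoidAlgebra.single a r - algebraMap 𝔽 (AddMonoidAlgebra 𝔽 K) r =
        algebraMap 𝔽 _ r * (AddMonoidAlgebra.single a 1 - 1) := by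
      rw [mul_sub, mul_one, ← Algebra.smul_def, AddMonoidAlgebra.smul_single, smul_eq_mul, mul_one]
    rw [this]
    exact Ideal.mul_mem_left _ _ (single_sub_one_mem_augIdeal a)

lemma augIdeal_le_jacobson_bot (p : ℕ) [Fact p.Prime] [CharP K p] [CharP 𝔽 p] :
    augIdeal K 𝔽 ≤ Ideal.jacobson ⊥ := by
  have : CharP (AddMonoidAlgebra 𝔽 K) p :=
    charP_of_injective_algebraMap (algebraMap 𝔽 (AddMonoidAlgebra 𝔽 K)).injective p
  refine le_trans ?_ (Ideal.radical_le_jacobson (I := ⊥))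
  rw [augIdeal, Ideal.span_le]
  rintro _ ⟨a, rfl⟩
  refine ⟨p, ?_⟩
  rw [sub_pow_char, AddMonoidAlgebra.single_pow]
  simp [AddMonoidAlgebra.one_def]

/-- The additive map `a ↦ [a] - 1` to the group algebra modulo the square of the
augmentation ideal. -/
noncomputable def augDeriv (K 𝔽 : Type*) [Field K] [Field 𝔽] :
    K →+ AddMonoidAlgebra 𝔽 K ⧸ (augIdeal K 𝔽 * augIdeal K 𝔽) :=
  AddMonoidHom.mk' (fun a ↦ Ideal.Quotient.mk _ (AddMonoidAlgebra.single a 1 - 1)) fun a b ↦ by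
    rw [← map_add, Ideal.Quotient.eq]
    have : (AddMonoidAlgebra.single (a + b) (1 : 𝔽) - 1) -
        (AddMonoidAlgebra.single a 1 - 1 + (AddMonoidAlgebra.single b 1 - 1)) =
        (AddMonoidAlgebra.single a 1 - 1) * (AddMonoidAlgebra.single b 1 - 1) := by
      have : AddMonoidAlgebra.single (a + b) (1 : 𝔽) =
          AddMonoidAlgebra.single a 1 * AddMonoidAlgebra.single b 1 := by
        rw [AddMonoidAlgebra.single_mul_single, one_mul]
      rw [this]
      ring
    rw [this]
    exact Ideal.mul_mem_mul (single_sub_one_mem_augIdeal a) (single_sub_one_mem_augIdeal b)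

lemma augDeriv_apply (a : K) :
    augDeriv K 𝔽 a = Ideal.Quotient.mk _ (AddMonoidAlgebra.single a 1 - 1) := rfl

lemma augDeriv_algebraMap_mul {p : ℕ} [NeZero p] [Algebra (ZMod p) K] [Algebra (ZMod p) 𝔽]
    (c : ZMod p) (a : K) :
    augDeriv K 𝔽 (algebraMap (ZMod p) K c * a) =
      algebraMap 𝔽 _ (algebraMap (ZMod p) 𝔽 c) * augDeriv K 𝔽 a := by
  obtain ⟨n, rfl⟩ := ZMod.natCast_zmod_surjective c
  simp only [map_natCast, ← nsmul_eq_mul, map_nsmul]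

end

section

variable {p : ℕ} [Fact p.Prime] [NeZero p] {K 𝔽 : Type*} [Field K] [Fintype K] [DecidableEq K]
  [Algebra (ZMod p) K] [Field 𝔽] [Algebra (ZMod p) 𝔽]

lemma sum_trace_mul_inv_mul (hp : 2 < p) (a : K) :
    ∑ b : Kˣ, algebraMap (ZMod p) K (Algebra.trace (ZMod p) K (a * (b : K)⁻¹)) * (b : K) = -a := by
  have hn0 : 0 < Module.finrank (ZMod p) K := Module.finrank_pos
  have hcard : Fintype.card K = p ^ Module.finrank (ZMod p) K := by
    rw [Module.card_eq_pow_finrank (K := ZMod p), ZMod.card]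
  have key (i : ℕ) (hi : i < Module.finrank (ZMod p) K) :
      ∑ b : Kˣ, (a * (b : K)⁻¹) ^ p ^ i * (b : K) = if i = 0 then -a else 0 := by
    have hpos : 1 ≤ p ^ i := Nat.one_le_pow _ _ (by omega)
    have h1 : ∑ b : Kˣ, (a * (b : K)⁻¹) ^ p ^ i * (b : K) =
        a ^ p ^ i * ∑ b : Kˣ, ((b : K) ^ (p ^ i - 1)) := by
      rw [Finset.mul_sum, ← Equiv.sum_comp (Equiv.inv Kˣ)]
      refine Finset.sum_congr rfl fun b _ ↦ ?_
      obtain ⟨m, hm⟩ := Nat.exists_eq_add_of_le' hpos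
      rw [hm]
      have := b.ne_zero
      simp only [Equiv.inv_apply, Units.val_inv_eq_inv_val, inv_inv, Nat.add_sub_cancel]
      field_simp
      ring
    rw [h1, FiniteField.sum_pow_units]
    have h2 : Fintype.card K - 1 ∣ p ^ i - 1 ↔ i = 0 := by
      refine ⟨fun h ↦ ?_, fun h ↦ by simp [h]⟩
      by_contra h0
      have h3 : p ^ i < p ^ Module.finrank (ZMod p) K := Nat.pow_lt_pow_right (by omega) hi
      have h4 : 1 < p ^ i := Nat.one_lt_pow h0 (by omega)
      have := Nat.le_of_dvd (by omega) h
      omega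
    by_cases h : i = 0 <;> simp [h2, h]
  simp_rw [FiniteField.algebraMap_trace_eq_sum_pow, Finset.sum_mul, Nat.card_zmod]
  rw [Finset.sum_comm, Finset.sum_congr rfl fun i hi ↦ key i (Finset.mem_range.1 hi)]
  simp [hn0]

lemma sum_units_inv (hp : 2 < p) : ∑ b : Kˣ, (b : K)⁻¹ = 0 := by
  have hcard : Fintype.card K = p ^ Module.finrank (ZMod p) K := by
    rw [Module.card_eq_pow_finrank (K := ZMod p), ZMod.card]
  have hle : p ≤ p ^ Module.finrank (ZMod p) K :=
    Nat.le_self_pow Module.finrank_pos.ne' p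
  rw [← Equiv.sum_comp (Equiv.inv Kˣ)]
  have h := FiniteField.sum_pow_units K 1
  rw [if_neg (by rw [Nat.dvd_one]; omega)] at h
  simpa using h

lemma sum_units_trace_mul_inv (hp : 2 < p) (a : K) :
    ∑ b : Kˣ, Algebra.trace (ZMod p) K (a * (b : K)⁻¹) = 0 := by
  rw [← map_sum, ← Finset.mul_sum, sum_units_inv hp, mul_zero, map_zero]

lemma sum_smul_Yelt (σ₀ : K →+* 𝔽) (a : K) :
    ∑ i ∈ Finset.range (Module.finrank (ZMod p) K), (σ₀ a ^ p ^ i) • Yelt p σ₀ i =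
      ∑ b : Kˣ, AddMonoidAlgebra.single (b : K)
        (algebraMap (ZMod p) 𝔽 (Algebra.trace (ZMod p) K (a * (b : K)⁻¹))) := by
  simp_rw [Yelt, Finset.smul_sum]
  rw [Finset.sum_comm]
  refine Finset.sum_congr rfl fun b _ ↦ ?_
  simp_rw [AddMonoidAlgebra.smul_single]
  have := map_sum (AddMonoidAlgebra.singleAddHom (R := 𝔽) (b : K))
    (fun i ↦ σ₀ a ^ p ^ i • (σ₀ (b : K) ^ p ^ i)⁻¹) (Finset.range (Module.finrank (ZMod p) K))
  refine this.symm.trans ?_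
  change AddMonoidAlgebra.single (b : K) _ = _
  congr 1
  rw [← ringHom_algebraMap_zmod σ₀, FiniteField.algebraMap_trace_eq_sum_pow]
  simp [mul_pow]

/-- Modulo the square of the augmentation ideal, `[a] - 1 = -∑ σ_i(a) Y_i`. -/
lemma sum_smul_Yelt_add_mem (hp : 2 < p) (σ₀ : K →+* 𝔽) (a : K) :
    ∑ i ∈ Finset.range (Module.finrank (ZMod p) K), (σ₀ a ^ p ^ i) • Yelt p σ₀ i +
      (AddMonoidAlgebra.single a 1 - 1) ∈ augIdeal K 𝔽 * augIdeal K 𝔽 := by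
  have h1 : ∑ i ∈ Finset.range (Module.finrank (ZMod p) K), (σ₀ a ^ p ^ i) • Yelt p σ₀ i =
      ∑ b : Kˣ, algebraMap 𝔽 (AddMonoidAlgebra 𝔽 K)
        (algebraMap (ZMod p) 𝔽 (Algebra.trace (ZMod p) K (a * (b : K)⁻¹))) *
          (AddMonoidAlgebra.single (b : K) 1 - 1) := by
    simp_rw [mul_sub, mul_one]
    rw [Finset.sum_sub_distrib, ← map_sum, ← map_sum, sum_units_trace_mul_inv hp, sum_smul_Yelt]
    simp
  rw [← Ideal.Quotient.eq_zero_iff_mem, map_add, ← augDeriv_apply, h1, map_sum]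
  simp_rw [map_mul, ← augDeriv_apply]
  have h2 (b : Kˣ) := augDeriv_algebraMap_mul (𝔽 := 𝔽)
    (Algebra.trace (ZMod p) K (a * (b : K)⁻¹)) (b : K)
  have h3 : ∑ b : Kˣ, augDeriv K 𝔽 (algebraMap (ZMod p) K
      (Algebra.trace (ZMod p) K (a * (b : K)⁻¹)) * (b : K)) + augDeriv K 𝔽 a = 0 := by
    rw [← map_sum, sum_trace_mul_inv_mul hp, map_neg, neg_add_cancel]
  rw [← h3]
  simp_rw [h2]
  rfl

lemma Yelt_zero_pow (hp : 2 < p) (σ₀ : K →+* 𝔽) : Yelt p σ₀ 0 ^ p = 0 := by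
  have : CharP 𝔽 p := charP_of_injective_algebraMap (algebraMap (ZMod p) 𝔽).injective p
  have : CharP K p := charP_of_injective_algebraMap (algebraMap (ZMod p) K).injective p
  have : CharP (AddMonoidAlgebra 𝔽 K) p :=
    charP_of_injective_algebraMap (algebraMap 𝔽 (AddMonoidAlgebra 𝔽 K)).injective p
  rw [Yelt, sum_pow_char]
  simp_rw [AddMonoidAlgebra.single_pow]
  have h : ∑ b : Kˣ, AddMonoidAlgebra.singleAddHom (0 : K) (((σ₀ (b : K))⁻¹) ^ p) = 0 := by
    rw [← map_sum, ← sum_pow_char]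
    simp_rw [← map_inv₀]
    rw [← map_sum, sum_units_inv hp, map_zero, zero_pow (by omega), map_zero]
  rw [← h]
  refine Finset.sum_congr rfl fun b _ ↦ ?_
  simp

/-- An ideal containing all the differences `Y_i - Y_j` generates, together with `Y_0`, the
augmentation ideal. -/
lemma augIdeal_le (hp : 2 < p) (σ₀ : K →+* 𝔽) (J : Ideal (AddMonoidAlgebra 𝔽 K))
    (hJ : ∀ i j : ℕ, i < j → j ≤ Module.finrank (ZMod p) K - 1 → Yelt p σ₀ i - Yelt p σ₀ j ∈ J) :
    augIdeal K 𝔽 ≤ J ⊔ Ideal.span {Yelt p σ₀ 0} := by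
  have : CharP 𝔽 p := charP_of_injective_algebraMap (algebraMap (ZMod p) 𝔽).injective p
  have : CharP K p := charP_of_injective_algebraMap (algebraMap (ZMod p) K).injective p
  have hY (i : ℕ) (hi : i < Module.finrank (ZMod p) K) :
      Yelt p σ₀ i ∈ J ⊔ Ideal.span {Yelt p σ₀ 0} := by
    have h0 : Yelt p σ₀ 0 ∈ J ⊔ Ideal.span {Yelt p σ₀ 0} :=
      Ideal.mem_sup_right (Ideal.mem_span_singleton_self _)
    obtain rfl | hi0 := Nat.eq_zero_or_pos i
    · exact h0
    · rw [← sub_sub_self (Yelt p σ₀ 0) (Yelt p σ₀ i)]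
      exact sub_mem h0 (Ideal.mem_sup_left (hJ 0 i hi0 (by omega)))
  refine Submodule.le_of_le_smul_of_le_jacobson_bot
    (Submodule.fg_span (Set.finite_range _)) (augIdeal_le_jacobson_bot p) ?_
  rw [augIdeal, Ideal.span_le, ← augIdeal]
  rintro _ ⟨a, rfl⟩
  change AddMonoidAlgebra.single a 1 - 1 ∈ _
  have h := sum_smul_Yelt_add_mem hp σ₀ a
  rw [← add_sub_cancel_left (∑ i ∈ Finset.range (Module.finrank (ZMod p) K),
    (σ₀ a ^ p ^ i) • Yelt p σ₀ i) (AddMonoidAlgebra.single a 1 - 1)]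
  refine sub_mem (Submodule.mem_sup_right h) (Submodule.mem_sup_left (sum_mem fun i hi ↦ ?_))
  rw [Algebra.smul_def]
  exact Ideal.mul_mem_left _ _ (hY i (Finset.mem_range.1 hi))

lemma restrictScalars_sup_span_pow_eq_top (hp : 2 < p) (σ₀ : K →+* 𝔽)
    (J : Ideal (AddMonoidAlgebra 𝔽 K))
    (hJ : ∀ i j : ℕ, i < j → j ≤ Module.finrank (ZMod p) K - 1 → Yelt p σ₀ i - Yelt p σ₀ j ∈ J) :
    J.restrictScalars 𝔽 ⊔ Submodule.span 𝔽 (Set.range fun k : Fin p ↦ Yelt p σ₀ 0 ^ (k : ℕ)) =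
      ⊤ := by
  set M := J.restrictScalars 𝔽 ⊔
    Submodule.span 𝔽 (Set.range fun k : Fin p ↦ Yelt p σ₀ 0 ^ (k : ℕ))
  have key (n : ℕ) (hn : n ≤ p) (x : AddMonoidAlgebra 𝔽 K) :
      ∃ m ∈ M, ∃ r, x = m + r * Yelt p σ₀ 0 ^ n := by
    induction n with
    | zero => exact ⟨0, zero_mem _, x, by simp⟩
    | succ n ih =>
      obtain ⟨m, hm, r, hr⟩ := ih (by omega)
      obtain ⟨c, hc⟩ := exists_sub_algebraMap_mem_augIdeal r
      obtain ⟨j, hj, s, hs, hjs⟩ := Submodule.mem_sup.1 (augIdeal_le hp σ₀ J hJ hc)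
      obtain ⟨t, rfl⟩ := Ideal.mem_span_singleton'.1 hs
      refine ⟨m + (j * Yelt p σ₀ 0 ^ n + c • Yelt p σ₀ 0 ^ n), add_mem hm (add_mem ?_ ?_), t, ?_⟩
      · exact Submodule.mem_sup_left (Ideal.mul_mem_right _ _ hj)
      · exact Submodule.mem_sup_right (Submodule.smul_mem _ _
          (Submodule.subset_span ⟨⟨n, by omega⟩, rfl⟩))
      · rw [hr, ← sub_add_cancel r (algebraMap 𝔽 _ c), ← hjs, Algebra.smul_def]
        ring
  rw [eq_top_iff]
  rintro x -
  obtain ⟨m, hm, r, rfl⟩ := key p le_rfl x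
  rwa [Yelt_zero_pow hp, mul_zero, add_zero]

/-- An ideal contained in the kernel of a surjection `g` onto a space of dimension `p` that contains
all the differences `Y_i - Y_j` is the whole kernel. -/
lemma ker_eq_restrictScalars_of_finrank_eq (hp : 2 < p) (σ₀ : K →+* 𝔽) (J : Ideal (AddMonoidAlgebra 𝔽 K))
    (hJ : ∀ i j : ℕ, i < j → j ≤ Module.finrank (ZMod p) K - 1 → Yelt p σ₀ i - Yelt p σ₀ j ∈ J)
    {V : Type*} [AddCommGroup V] [Module 𝔽 V] (hV : Module.finrank 𝔽 V = p)
    (g : AddMonoidAlgebra 𝔽 K →ₗ[𝔽] V) (hg : Function.Surjective g)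
    (hle : J.restrictScalars 𝔽 ≤ LinearMap.ker g) : LinearMap.ker g = J.restrictScalars 𝔽 := by
  have : Module.Finite 𝔽 (AddMonoidAlgebra 𝔽 K) :=
    Module.Finite.equiv (AddMonoidAlgebra.coeffLinearEquiv 𝔽).symm
  refine (Submodule.eq_of_le_of_finrank_le hle ?_).symm
  have h1 := LinearMap.finrank_range_add_finrank_ker g
  rw [LinearMap.range_eq_top.2 hg, finrank_top, hV] at h1
  have h2 := Submodule.finrank_add_le_finrank_add_finrank (J.restrictScalars 𝔽)
    (Submodule.span 𝔽 (Set.range fun k : Fin p ↦ Yelt p σ₀ 0 ^ (k : ℕ)))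
  rw [restrictScalars_sup_span_pow_eq_top hp σ₀ J hJ, finrank_top] at h2
  have h3 := finrank_range_le_card (R := 𝔽) (fun k : Fin p ↦ Yelt p σ₀ 0 ^ (k : ℕ))
  rw [Set.finrank, Fintype.card_fin] at h3
  omega

end

/-- Lemma `lem:ker`, §3.2.2, at the level of the finite quotients
`N_0/N_0^p ≅ K` and `N_0/N_1 N_0^p ≅ 𝔽_p`.  The `𝔽`-algebra map
`tr : 𝔽[K] → 𝔽[𝔽_p]` induced by the trace satisfies `tr (Y_j) = Y` for `0 ≤ j ≤ f−1`,
is surjective, and its kernel is the ideal generated by the `Y_i − Y_j`,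
`0 ≤ i < j ≤ f−1`. -/
theorem statement13 (p f : ℕ) [Fact p.Prime] [NeZero p] (hp : 2 < p) (hf : 1 ≤ f)
    (K : Type*) [Field K] [Fintype K] [DecidableEq K] [Algebra (ZMod p) K] (hK : Fintype.card K = p ^ f)
    (𝔽 : Type*) [Field 𝔽] [Algebra (ZMod p) 𝔽] (σ₀ : K →+* 𝔽) :
    (∀ j ≤ f - 1,
      AddMonoidAlgebra.mapDomainRingHom 𝔽 (Algebra.trace (ZMod p) K).toAddMonoidHom
        (Yelt p σ₀ j) = Ystd p 𝔽) ∧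
    Function.Surjective
      ⇑(AddMonoidAlgebra.mapDomainRingHom 𝔽 (Algebra.trace (ZMod p) K).toAddMonoidHom :
        AddMonoidAlgebra 𝔽 K →+* AddMonoidAlgebra 𝔽 (ZMod p)) ∧
    RingHom.ker
        (AddMonoidAlgebra.mapDomainRingHom 𝔽 (Algebra.trace (ZMod p) K).toAddMonoidHom :
          AddMonoidAlgebra 𝔽 K →+* AddMonoidAlgebra 𝔽 (ZMod p))
      = Ideal.span {x | ∃ i j : ℕ, i < j ∧ j ≤ f - 1 ∧ x = Yelt p σ₀ i - Yelt p σ₀ j} := by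
  have hfin : Module.finrank (ZMod p) K = f := by
    have h := Module.card_eq_pow_finrank (K := ZMod p) (V := K)
    rw [hK, ZMod.card] at h
    exact (Nat.pow_right_injective (by omega) h).symm
  have hY (j : ℕ) := mapDomainRingHom_trace_Yelt p hp (K := K) (𝔽 := 𝔽) σ₀ j
  have hsurj : Function.Surjective
      ⇑(AddMonoidAlgebra.mapDomainRingHom 𝔽 (Algebra.trace (ZMod p) K).toAddMonoidHom :
        AddMonoidAlgebra 𝔽 K →+* AddMonoidAlgebra 𝔽 (ZMod p)) := by
    intro y
    induction y using AddMonoidAlgebra.induction_linear with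
    | zero => exact ⟨0, map_zero _⟩
    | add x y hx hy =>
      obtain ⟨x, rfl⟩ := hx
      obtain ⟨y, rfl⟩ := hy
      exact ⟨x + y, map_add _ _ _⟩
    | single b r =>
      obtain ⟨a, rfl⟩ := Algebra.trace_surjective (ZMod p) K b
      exact ⟨AddMonoidAlgebra.single a r, by simp⟩
  refine ⟨fun j _ ↦ hY j, hsurj, ?_⟩
  let g : AddMonoidAlgebra 𝔽 K →ₗ[𝔽] AddMonoidAlgebra 𝔽 (ZMod p) :=
    { AddMonoidAlgebra.mapDomainRingHom 𝔽 (Algebra.trace (ZMod p) K).toAddMonoidHom with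
      map_smul' := fun c x ↦ by
        change AddMonoidAlgebra.mapDomainRingHom _ _ _ = c • AddMonoidAlgebra.mapDomainRingHom _ _ _
        rw [Algebra.smul_def, map_mul, Algebra.smul_def]
        congr 1
        simp }
  have hV : Module.finrank 𝔽 (AddMonoidAlgebra 𝔽 (ZMod p)) = p := by
    rw [(AddMonoidAlgebra.coeffLinearEquiv 𝔽).finrank_eq, Module.finrank_finsupp_self, ZMod.card]
  have hle : Ideal.span {x | ∃ i j : ℕ, i < j ∧ j ≤ f - 1 ∧ x = Yelt p σ₀ i - Yelt p σ₀ j} ≤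
      RingHom.ker
        (AddMonoidAlgebra.mapDomainRingHom 𝔽 (Algebra.trace (ZMod p) K).toAddMonoidHom :
          AddMonoidAlgebra 𝔽 K →+* AddMonoidAlgebra 𝔽 (ZMod p)) := by
    rw [Ideal.span_le]
    rintro _ ⟨i, j, -, -, rfl⟩
    rw [SetLike.mem_coe, RingHom.mem_ker, map_sub, hY, hY, sub_self]
  have hker := ker_eq_restrictScalars_of_finrank_eq hp σ₀
    (Ideal.span {x | ∃ i j : ℕ, i < j ∧ j ≤ f - 1 ∧ x = Yelt p σ₀ i - Yelt p σ₀ j})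
    (fun i j hij hj ↦ Ideal.subset_span ⟨i, j, hij, hfin ▸ hj, rfl⟩) hV g hsurj
    (fun x hx ↦ hle hx)
  exact SetLike.ext fun x ↦ SetLike.ext_iff.1 hker x

end BHHMS
end
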